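/- Under the multiplex RWM recursion, for every network index i and every natural number t, the modified transition matrices satisfy ‖𝒫_i^{(t+1)} − 𝒫_i^{(t)}‖_∞ ≤ λ^t · K. -/

import Mathlib

open Finset Filter Matrix Topology

/-- Cosine similarity of two vectors in `ℝ^n` (0 when a denominator vanishes,
since division by zero is 0 in Lean). -/
noncomputable def cosSim {n : ℕ} (u v : Fin n → ℝ) : ℝ :=
  (∑ k, u k * v k) / (Real.sqrt (∑ k, u k * u k) * Real.sqrt (∑ k, v k * v k))

/-- The maximum of the absolute values of the entries of a real matrix. -/
noncomputable def matInfNorm {m n : ℕ} (M : Matrix (Fin m) (Fin n) ℝ) : ℝ :=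
  ⨆ p : Fin m × Fin n, |M p.1 p.2|

/-- The joint state `(W^{(t)}, x^{(t)})` of the multiplex RWM recursion:
`W^{(0)} = I`, `x^{(0)}` given; `Ŵ^{(t)}(i,j) = W^{(t)}(i,j)/∑_k W^{(t)}(i,k)`,
`𝒫_i^{(t)} = ∑_j Ŵ^{(t)}(i,j) P_j`, `x_i^{(t+1)} = 𝒫_i^{(t)} x_i^{(t)}`, and
`W^{(t+1)}(i,j) = W^{(t)}(i,j) + λ^{t+1} cos(x_i^{(t+1)}, x_j^{(t+1)})`. -/
noncomputable def rwmState {K n : ℕ} (lam : ℝ) (P : Fin K → Matrix (Fin n) (Fin n) ℝ)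
    (x0 : Fin K → Fin n → ℝ) : ℕ → Matrix (Fin K) (Fin K) ℝ × (Fin K → Fin n → ℝ)
  | 0 => (1, x0)
  | t + 1 =>
      let Wt := (rwmState lam P x0 t).1
      let xt := (rwmState lam P x0 t).2
      let What : Matrix (Fin K) (Fin K) ℝ := Matrix.of fun i j => Wt i j / ∑ k, Wt i k
      let Pmod : Fin K → Matrix (Fin n) (Fin n) ℝ := fun i => ∑ j, What i j • P j
      let xNew : Fin K → Fin n → ℝ := fun i => (Pmod i).mulVec (xt i)
      (Matrix.of fun i j => Wt i j + lam ^ (t + 1) * cosSim (xNew i) (xNew j), xNew)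

/-- The relevance weight matrix `W^{(t)}`. -/
noncomputable def rwmW {K n : ℕ} (lam : ℝ) (P : Fin K → Matrix (Fin n) (Fin n) ℝ)
    (x0 : Fin K → Fin n → ℝ) (t : ℕ) : Matrix (Fin K) (Fin K) ℝ :=
  (rwmState lam P x0 t).1

/-- The visiting probability vector `x_i^{(t)}`. -/
noncomputable def rwmX {K n : ℕ} (lam : ℝ) (P : Fin K → Matrix (Fin n) (Fin n) ℝ)
    (x0 : Fin K → Fin n → ℝ) (t : ℕ) (i : Fin K) : Fin n → ℝ :=
  (rwmState lam P x0 t).2 i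

/-- The row-normalized relevance weight matrix `Ŵ^{(t)}`. -/
noncomputable def rwmWhat {K n : ℕ} (lam : ℝ) (P : Fin K → Matrix (Fin n) (Fin n) ℝ)
    (x0 : Fin K → Fin n → ℝ) (t : ℕ) : Matrix (Fin K) (Fin K) ℝ :=
  Matrix.of fun i j => rwmW lam P x0 t i j / ∑ k, rwmW lam P x0 t i k

/-- The modified transition matrix `𝒫_i^{(t)} = ∑_j Ŵ^{(t)}(i,j) P_j`. -/
noncomputable def rwmPmod {K n : ℕ} (lam : ℝ) (P : Fin K → Matrix (Fin n) (Fin n) ℝ)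
    (x0 : Fin K → Fin n → ℝ) (t : ℕ) (i : Fin K) : Matrix (Fin n) (Fin n) ℝ :=
  ∑ j, rwmWhat lam P x0 t i j • P j

theorem cosSim_nonneg {n : ℕ} {u v : Fin n → ℝ} (hu : ∀ k, 0 ≤ u k) (hv : ∀ k, 0 ≤ v k) :
    0 ≤ cosSim u v :=
  div_nonneg (Finset.sum_nonneg fun k _ => mul_nonneg (hu k) (hv k)) (by positivity)

theorem cosSim_le_one {n : ℕ} (u v : Fin n → ℝ) : cosSim u v ≤ 1 := by
  refine div_le_one_of_le₀ ?_ (by positivity)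
  simpa only [sq] using Real.sum_mul_le_sqrt_mul_sqrt Finset.univ u v

theorem rwmX_succ {K n : ℕ} (lam : ℝ) (P : Fin K → Matrix (Fin n) (Fin n) ℝ)
    (x0 : Fin K → Fin n → ℝ) (t : ℕ) (i : Fin K) :
    rwmX lam P x0 (t + 1) i = (rwmPmod lam P x0 t i).mulVec (rwmX lam P x0 t i) := rfl

theorem rwmW_succ {K n : ℕ} (lam : ℝ) (P : Fin K → Matrix (Fin n) (Fin n) ℝ)
    (x0 : Fin K → Fin n → ℝ) (t : ℕ) (i j : Fin K) :
    rwmW lam P x0 (t + 1) i j = rwmW lam P x0 t i j +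
      lam ^ (t + 1) * cosSim (rwmX lam P x0 (t + 1) i) (rwmX lam P x0 (t + 1) j) := rfl

theorem rwmPmod_apply {K n : ℕ} (lam : ℝ) (P : Fin K → Matrix (Fin n) (Fin n) ℝ)
    (x0 : Fin K → Fin n → ℝ) (t : ℕ) (i : Fin K) (v u : Fin n) :
    rwmPmod lam P x0 t i v u =
      (∑ j, rwmW lam P x0 t i j * P j v u) / ∑ k, rwmW lam P x0 t i k := by
  simp only [rwmPmod, rwmWhat, Matrix.sum_apply, Matrix.smul_apply, Matrix.of_apply,
    smul_eq_mul, Finset.sum_div]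
  exact Finset.sum_congr rfl fun j _ => by ring

/-- The weights and the visiting probabilities stay nonnegative, and the diagonal weights
stay at least one. -/
theorem rwm_nonneg_and_one_le_diag {K n : ℕ} {lam : ℝ} (hlam : 0 ≤ lam)
    {P : Fin K → Matrix (Fin n) (Fin n) ℝ} (hP : ∀ j v u, 0 ≤ P j v u)
    {x0 : Fin K → Fin n → ℝ} (hx0 : ∀ i v, 0 ≤ x0 i v) (t : ℕ) :
    (∀ i j, 0 ≤ rwmW lam P x0 t i j) ∧ (∀ i, 1 ≤ rwmW lam P x0 t i i) ∧
      ∀ i v, 0 ≤ rwmX lam P x0 t i v := by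
  induction t with
  | zero =>
    refine ⟨fun i j => ?_, fun i => ?_, hx0⟩
    · change 0 ≤ (1 : Matrix (Fin K) (Fin K) ℝ) i j
      rw [Matrix.one_apply]
      split_ifs <;> norm_num
    · change 1 ≤ (1 : Matrix (Fin K) (Fin K) ℝ) i i
      rw [Matrix.one_apply_eq]
  | succ t ih =>
    obtain ⟨hW, hd, hx⟩ := ih
    have hx' : ∀ i v, 0 ≤ rwmX lam P x0 (t + 1) i v := fun i v => by
      rw [rwmX_succ, Matrix.mulVec, dotProduct]
      refine Finset.sum_nonneg fun u _ => mul_nonneg ?_ (hx i u)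
      rw [rwmPmod_apply]
      exact div_nonneg (Finset.sum_nonneg fun j _ => mul_nonneg (hW i j) (hP j v u))
        (Finset.sum_nonneg fun k _ => hW i k)
    have hc : ∀ i j, 0 ≤ lam ^ (t + 1) *
        cosSim (rwmX lam P x0 (t + 1) i) (rwmX lam P x0 (t + 1) j) := fun i j =>
      mul_nonneg (pow_nonneg hlam _) (cosSim_nonneg (hx' i) (hx' j))
    refine ⟨fun i j => ?_, fun i => ?_, hx'⟩
    · rw [rwmW_succ]
      exact add_nonneg (hW i j) (hc i j)
    · rw [rwmW_succ]
      linarith [hd i, hc i i]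

/-- Adding total mass `D ≥ 0` to weights of total mass `S ≥ 1` moves a weighted mean of
numbers in `[0, 1]` by at most `D`. -/
theorem abs_weighted_mean_sub_le {S D A B : ℝ} (hS : 1 ≤ S) (hA0 : 0 ≤ A) (hAS : A ≤ S)
    (hB0 : 0 ≤ B) (hBD : B ≤ D) : |(A + B) / (S + D) - A / S| ≤ D := by
  have hD : 0 ≤ D := hB0.trans hBD
  have hS0 : 0 < S := by linarith
  have hSD : 0 < S + D := by linarith
  have hm0 : 0 ≤ A / S := by positivity
  have hm1 : A / S ≤ 1 := div_le_one_of_le₀ hAS hS0.le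
  have key : (A + B) / (S + D) - A / S = (B - A / S * D) / (S + D) := by
    field_simp
    ring
  have hnum : |B - A / S * D| ≤ D := by
    rw [abs_le]
    constructor <;> nlinarith
  rw [key, abs_div, abs_of_pos hSD]
  exact (div_le_self (abs_nonneg _) (by linarith)).trans hnum

/-- Under the multiplex RWM recursion, for every network index `i` and every natural
number `t`, the modified transition matrices satisfy
`‖𝒫_i^{(t+1)} − 𝒫_i^{(t)}‖_∞ ≤ λ^t · K`. -/
theorem rwm_multiplex_transition_geometric_bound
    (K n : ℕ) (hK : 1 ≤ K) (hn : 1 ≤ n)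
    (lam : ℝ) (hlam0 : 0 < lam) (hlam1 : lam < 1)
    (P : Fin K → Matrix (Fin n) (Fin n) ℝ)
    (hPnn : ∀ j v u, 0 ≤ P j v u) (hPcol : ∀ j u, ∑ v, P j v u = 1)
    (x0 : Fin K → Fin n → ℝ)
    (hx0nn : ∀ i v, 0 ≤ x0 i v) (hx0sum : ∀ i, ∑ v, x0 i v = 1) :
    ∀ (i : Fin K) (t : ℕ),
      matInfNorm (rwmPmod lam P x0 (t + 1) i - rwmPmod lam P x0 t i) ≤ lam ^ t * K := by
  intro i t
  obtain ⟨hW, hd, -⟩ := rwm_nonneg_and_one_le_diag hlam0.le hPnn hx0nn t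
  obtain ⟨-, -, hx⟩ := rwm_nonneg_and_one_le_diag hlam0.le hPnn hx0nn (t + 1)
  have hP1 : ∀ j v u, P j v u ≤ 1 := fun j v u => by
    rw [← hPcol j u]
    exact Finset.single_le_sum (f := fun v => P j v u) (fun w _ => hPnn j w u)
      (Finset.mem_univ v)
  set δ : Fin K → ℝ := fun j =>
    lam ^ (t + 1) * cosSim (rwmX lam P x0 (t + 1) i) (rwmX lam P x0 (t + 1) j)
  have hδ0 : ∀ j, 0 ≤ δ j := fun j =>
    mul_nonneg (pow_nonneg hlam0.le _) (cosSim_nonneg (hx i) (hx j))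
  have hδ1 : ∀ j, δ j ≤ lam ^ t := fun j =>
    (mul_le_of_le_one_right (pow_nonneg hlam0.le _) (cosSim_le_one _ _)).trans
      (pow_le_pow_of_le_one hlam0.le hlam1.le t.le_succ)
  have hsum : ∑ j, δ j ≤ lam ^ t * K := by
    calc ∑ j, δ j ≤ ∑ _j : Fin K, lam ^ t := Finset.sum_le_sum fun j _ => hδ1 j
      _ = lam ^ t * K := by simp [mul_comm]
  refine Real.iSup_le (fun ⟨v, u⟩ => ?_) (by positivity)
  have hWδ : ∀ j, rwmW lam P x0 (t + 1) i j = rwmW lam P x0 t i j + δ j := fun j =>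
    rwmW_succ lam P x0 t i j
  rw [Matrix.sub_apply, rwmPmod_apply, rwmPmod_apply]
  simp only [hWδ, add_mul, Finset.sum_add_distrib]
  refine (abs_weighted_mean_sub_le ?_ ?_ ?_ ?_ ?_).trans hsum
  · exact (hd i).trans (Finset.single_le_sum (fun j _ => hW i j) (Finset.mem_univ i))
  · exact Finset.sum_nonneg fun j _ => mul_nonneg (hW i j) (hPnn j v u)
  · exact Finset.sum_le_sum fun j _ => mul_le_of_le_one_right (hW i j) (hP1 j v u)
  · exact Finset.sum_nonneg fun j _ => mul_nonneg (hδ0 j) (hPnn j v u)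
  · exact Finset.sum_le_sum fun j _ => mul_le_of_le_one_right (hδ0 j) (hP1 j v u)
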